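/- Let σ > 0, L > 0, Ω ∈ ℝ, θ ∈ [0,1], and for β ∈ ℝ define F_u(Ω;β) = (4π^(1/2)σ/L²) Σ_{n,m=1}^∞ exp[−σ²(Ω + 2π(n e^β + m e^(−β))/L)²] + (2π^(1/2)σ/L²) Σ_{n=1}^∞ { exp[−σ²(Ω + 2πn e^β/L)²] + exp[−σ²(Ω + 2πn e^(−β)/L)²] } + (2π^(1/2)σθ/L²) e^(−σ²Ω²). Then lim_{β→+∞} e^(−β) F_u(Ω;β) = erfc(σΩ) / (2L). -/

import Mathlib

open Filter
open scoped Topology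

/-- The complementary error function `erfc(x) = (2/√π) ∫_x^∞ e^{−t²} dt`. -/
noncomputable def erfc (x : ℝ) : ℝ :=
  (2 / Real.sqrt Real.pi) * ∫ t in Set.Ioi x, Real.exp (-t ^ 2)

section RiemannSum

open MeasureTheory Set

variable {f : ℝ → ℝ} {C k ε : ℝ}

lemma le_mul_natFloor_div_add_one (hε : 0 < ε) (x : ℝ) :
    x ≤ ε * ((⌊x / ε⌋₊ : ℝ) + 1) := by
  have := (Nat.lt_floor_add_one (x / ε)).le
  rwa [div_le_iff₀' hε] at this

lemma mul_natFloor_div_add_one_le (hε : 0 < ε) {x : ℝ} (hx : 0 ≤ x) :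
    ε * ((⌊x / ε⌋₊ : ℝ) + 1) ≤ x + ε := by
  have := Nat.floor_le (div_nonneg hx hε.le)
  rw [le_div_iff₀' hε] at this
  linarith

lemma norm_comp_natFloor_le (hk : 0 < k) (hf : ∀ x, |f x| ≤ C * Real.exp (-k * x))
    (hε : 0 < ε) (x : ℝ) :
    ‖f (ε * ((⌊x / ε⌋₊ : ℝ) + 1))‖ ≤ C * Real.exp (-k * x) := by
  have hC : 0 ≤ C := by simpa using (abs_nonneg _).trans (hf 0)
  refine (hf _).trans (mul_le_mul_of_nonneg_left (Real.exp_le_exp.2 ?_) hC)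
  nlinarith [le_mul_natFloor_div_add_one hε x]

lemma measurable_comp_natFloor (hfc : Continuous f) (ε : ℝ) :
    Measurable fun x : ℝ => f (ε * ((⌊x / ε⌋₊ : ℝ) + 1)) := by
  have : Measurable fun x : ℝ => (⌊x / ε⌋₊ : ℝ) :=
    measurable_from_nat.comp (Nat.measurable_floor.comp (measurable_id.div_const ε))
  exact hfc.measurable.comp ((this.add_const 1).const_mul ε)

lemma hasSum_riemannSum (hfc : Continuous f) (hk : 0 < k)
    (hf : ∀ x, |f x| ≤ C * Real.exp (-k * x)) (hε : 0 < ε) :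
    HasSum (fun n : ℕ => ε * f (ε * ((n : ℝ) + 1)))
      (∫ x in Ioi (0 : ℝ), f (ε * ((⌊x / ε⌋₊ : ℝ) + 1))) := by
  set s : ℕ → Set ℝ := fun n => Ico (ε * n) (ε * (n + 1)) with hs
  have mem_s : ∀ n x, x ∈ s n ↔ 0 ≤ x ∧ ⌊x / ε⌋₊ = n := by
    intro n x
    constructor
    · rintro ⟨h1, h2⟩
      have hx : 0 ≤ x := (by positivity : 0 ≤ ε * (n : ℝ)).trans h1
      refine ⟨hx, (Nat.floor_eq_iff (by positivity)).2 ⟨?_, ?_⟩⟩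
      · rwa [le_div_iff₀' hε]
      · rwa [div_lt_iff₀' hε]
    · rintro ⟨hx, h⟩
      obtain ⟨h1, h2⟩ := (Nat.floor_eq_iff (by positivity)).1 h
      rw [le_div_iff₀' hε] at h1
      rw [div_lt_iff₀' hε] at h2
      exact ⟨h1, h2⟩
  have hU : ⋃ n, s n = Ici 0 := by
    ext x
    simp [mem_s]
  have hd : Pairwise (Function.onFun Disjoint s) := by
    intro m n hmn
    refine Set.disjoint_left.2 fun x hm hn => hmn ?_
    rw [← ((mem_s _ _).1 hm).2, ((mem_s _ _).1 hn).2]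
  have hint : IntegrableOn (fun x : ℝ => f (ε * ((⌊x / ε⌋₊ : ℝ) + 1))) (⋃ n, s n) := by
    rw [hU, integrableOn_Ici_iff_integrableOn_Ioi]
    exact ((integrableOn_exp_mul_Ioi (neg_lt_zero.2 hk) 0).const_mul C).mono'
      (measurable_comp_natFloor hfc ε).aestronglyMeasurable
      (ae_of_all _ (norm_comp_natFloor_le hk hf hε))
  have h := hasSum_integral_iUnion (fun n => measurableSet_Ico) hd hint
  rw [hU, integral_Ici_eq_integral_Ioi] at h
  convert! h using 2 with n
  have : ∫ x in s n, f (ε * ((⌊x / ε⌋₊ : ℝ) + 1)) = ∫ x in s n, f (ε * ((n : ℝ) + 1)) :=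
    setIntegral_congr_fun measurableSet_Ico fun x hx => by simp only [((mem_s n x).1 hx).2]
  rw [this, setIntegral_const, Measure.real, Real.volume_Ico, ENNReal.toReal_ofReal (by linarith),
    smul_eq_mul]
  ring

lemma tendsto_riemannSum (hfc : Continuous f) (hk : 0 < k)
    (hf : ∀ x, |f x| ≤ C * Real.exp (-k * x)) :
    Tendsto (fun ε : ℝ => ε * ∑' n : ℕ, f (ε * ((n : ℝ) + 1))) (𝓝[>] 0)
      (𝓝 (∫ x in Ioi (0 : ℝ), f x)) := by
  have h : Tendsto (fun ε : ℝ => ∫ x in Ioi (0 : ℝ), f (ε * ((⌊x / ε⌋₊ : ℝ) + 1))) (𝓝[>] 0)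
      (𝓝 (∫ x in Ioi (0 : ℝ), f x)) := by
    refine tendsto_integral_filter_of_dominated_convergence (fun x => C * Real.exp (-k * x))
      (Eventually.of_forall fun ε => (measurable_comp_natFloor hfc ε).aestronglyMeasurable)
      ?_ ((integrableOn_exp_mul_Ioi (neg_lt_zero.2 hk) 0).const_mul C) ?_
    · filter_upwards [self_mem_nhdsWithin] with ε hε
      exact ae_of_all _ (norm_comp_natFloor_le hk hf hε)
    · refine (ae_restrict_iff' measurableSet_Ioi).2 (ae_of_all _ fun x hx => ?_)
      refine (hfc.tendsto x).comp ?_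
      have hε0 : Tendsto (fun ε : ℝ => x + ε) (𝓝[>] 0) (𝓝 x) := by
        have : Tendsto (fun ε : ℝ => x + ε) (𝓝 0) (𝓝 (x + 0)) := by
          exact (continuous_const.add continuous_id).tendsto 0
        rw [add_zero] at this
        exact this.mono_left nhdsWithin_le_nhds
      refine tendsto_of_tendsto_of_tendsto_of_le_of_le' tendsto_const_nhds hε0 ?_ ?_
      · filter_upwards [self_mem_nhdsWithin] with ε hε
        exact le_mul_natFloor_div_add_one hε x
      · filter_upwards [self_mem_nhdsWithin] with ε hε
        exact mul_natFloor_div_add_one_le hε (le_of_lt hx)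
  refine h.congr' ?_
  filter_upwards [self_mem_nhdsWithin] with ε hε
  rw [← tsum_mul_left]
  exact (hasSum_riemannSum hfc hk hf hε).tsum_eq.symm

end RiemannSum

section Gaussian

open MeasureTheory Set

variable {p q : ℝ}

lemma continuous_gaussian (p q : ℝ) : Continuous fun x : ℝ => Real.exp (-(p + q * x) ^ 2) := by
  fun_prop

lemma abs_gaussian_le (p : ℝ) (hq : 0 < q) (x : ℝ) :
    |Real.exp (-(p + q * x) ^ 2)| ≤
      Real.exp ((1 / (2 * q)) ^ 2 - p / q) * Real.exp (-1 * x) := by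
  rw [abs_of_pos (Real.exp_pos _), ← Real.exp_add, Real.exp_le_exp]
  have h : (p + q * x - 1 / (2 * q)) ^ 2 =
      (p + q * x) ^ 2 - p / q - x + (1 / (2 * q)) ^ 2 := by
    field_simp
    ring
  nlinarith [sq_nonneg (p + q * x - 1 / (2 * q))]

lemma summable_gaussian (p : ℝ) (hq : 0 < q) {ε : ℝ} (hε : 0 < ε) :
    Summable fun n : ℕ => Real.exp (-(p + q * (ε * ((n : ℝ) + 1))) ^ 2) :=
  (summable_mul_left_iff hε.ne').1
    (hasSum_riemannSum (continuous_gaussian p q) one_pos (abs_gaussian_le p hq) hε).summable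

lemma integral_gaussian_Ioi_zero_eq_erfc (p : ℝ) (hq : 0 < q) :
    ∫ x in Ioi (0 : ℝ), Real.exp (-(p + q * x) ^ 2) = Real.sqrt Real.pi / (2 * q) * erfc p := by
  have h1 := integral_comp_mul_left_Ioi (fun x : ℝ => Real.exp (-(p + x) ^ 2)) 0 hq
  have h2 := (measurePreserving_add_left (volume : Measure ℝ) p).setIntegral_preimage_emb
    (measurableEmbedding_addLeft p) (fun t : ℝ => Real.exp (-t ^ 2)) (Ioi p)
  rw [preimage_const_add_Ioi, sub_self] at h2
  rw [h1, mul_zero, h2, erfc, smul_eq_mul]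
  have : Real.sqrt Real.pi ≠ 0 := (Real.sqrt_pos.2 Real.pi_pos).ne'
  field_simp

lemma tendsto_gaussian_riemannSum (p : ℝ) (hq : 0 < q) :
    Tendsto (fun ε : ℝ => ε * ∑' n : ℕ, Real.exp (-(p + q * (ε * ((n : ℝ) + 1))) ^ 2)) (𝓝[>] 0)
      (𝓝 (Real.sqrt Real.pi / (2 * q) * erfc p)) := by
  rw [← integral_gaussian_Ioi_zero_eq_erfc p hq]
  exact tendsto_riemannSum (continuous_gaussian p q) one_pos (abs_gaussian_le p hq)

lemma tendsto_tsum_gaussian_atTop (hq : 0 < q) :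
    Tendsto (fun E : ℝ => ∑' n : ℕ, Real.exp (-(0 + q * (E * ((n : ℝ) + 1))) ^ 2)) atTop
      (𝓝 0) := by
  have h := tendsto_tsum_of_dominated_convergence (𝓕 := atTop)
    (f := fun (E : ℝ) (n : ℕ) => Real.exp (-(0 + q * (E * ((n : ℝ) + 1))) ^ 2))
    (g := fun _ => (0 : ℝ)) (summable_gaussian 0 hq one_pos) ?_ ?_
  · simpa using h
  · intro n
    have h1 : Tendsto (fun E : ℝ => 0 + q * (E * ((n : ℝ) + 1))) atTop atTop := by
      simp only [zero_add]
      exact (tendsto_id.atTop_mul_const (by positivity)).const_mul_atTop hq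
    exact Real.tendsto_exp_neg_atTop_nhds_zero.comp ((tendsto_pow_atTop two_ne_zero).comp h1)
  · filter_upwards [eventually_ge_atTop 1] with E hE n
    rw [Real.norm_of_nonneg (Real.exp_pos _).le, Real.exp_le_exp, neg_le_neg_iff]
    gcongr

/-- For large `E`, the offset `p` costs at most half of the slope. -/
lemma gaussian_add_le {E y : ℝ} (hE : -2 * p ≤ q * E) (hq : 0 ≤ q) (hE0 : 0 ≤ E) (hy : 0 ≤ y)
    (n : ℕ) :
    Real.exp (-(p + q * (E * ((n : ℝ) + 1)) + y) ^ 2) ≤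
      Real.exp (-(0 + q / 2 * (E * ((n : ℝ) + 1))) ^ 2) * Real.exp (-y ^ 2) := by
  rw [← Real.exp_add, Real.exp_le_exp]
  have hn : 0 ≤ q * E * n := by positivity
  have hX : 0 ≤ q / 2 * (E * ((n : ℝ) + 1)) := by positivity
  have h : q / 2 * (E * ((n : ℝ) + 1)) ≤ p + q * (E * ((n : ℝ) + 1)) := by nlinarith
  have h2 := mul_nonneg (hX.trans h) hy
  nlinarith

lemma eventually_neg_two_mul_le (p : ℝ) (hq : 0 < q) : ∀ᶠ E : ℝ in atTop, -2 * p ≤ q * E :=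
  (tendsto_id.const_mul_atTop hq).eventually_ge_atTop _

lemma tendsto_tsum_gaussian_shift_atTop (p : ℝ) (hq : 0 < q) :
    Tendsto (fun E : ℝ => ∑' n : ℕ, Real.exp (-(p + q * (E * ((n : ℝ) + 1))) ^ 2)) atTop
      (𝓝 0) := by
  refine squeeze_zero' (Eventually.of_forall fun E => tsum_nonneg fun n => (Real.exp_pos _).le) ?_
    (tendsto_tsum_gaussian_atTop (half_pos hq))
  filter_upwards [eventually_neg_two_mul_le p hq, eventually_gt_atTop 0] with E hE hE0
  refine (summable_gaussian p hq hE0).tsum_le_tsum (fun n => ?_)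
    (summable_gaussian 0 (half_pos hq) hE0)
  simpa using gaussian_add_le hE hq.le hE0.le le_rfl n

lemma tendsto_tsum_prod_gaussian (p : ℝ) (hq : 0 < q) :
    Tendsto (fun E : ℝ => E⁻¹ * ∑' m : ℕ × ℕ,
      Real.exp (-(p + q * (E * ((m.1 : ℝ) + 1)) + q * (E⁻¹ * ((m.2 : ℝ) + 1))) ^ 2)) atTop
      (𝓝 0) := by
  have hA := tendsto_tsum_gaussian_atTop (half_pos hq)
  have hB := (tendsto_gaussian_riemannSum 0 hq).comp tendsto_inv_atTop_nhdsGT_zero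
  have hAB := hA.mul hB
  rw [zero_mul] at hAB
  refine squeeze_zero' ?_ ?_ hAB
  · filter_upwards [eventually_gt_atTop 0] with E hE0
    exact mul_nonneg (inv_nonneg.2 hE0.le) (tsum_nonneg fun n => (Real.exp_pos _).le)
  · filter_upwards [eventually_neg_two_mul_le p hq, eventually_gt_atTop 0] with E hE hE0
    have sA := summable_gaussian 0 (half_pos hq) hE0
    have sB := summable_gaussian 0 hq (inv_pos.2 hE0)
    have sAB := summable_mul_of_summable_norm sA.norm sB.norm
    have hle : ∀ m : ℕ × ℕ,
        Real.exp (-(p + q * (E * ((m.1 : ℝ) + 1)) + q * (E⁻¹ * ((m.2 : ℝ) + 1))) ^ 2) ≤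
        Real.exp (-(0 + q / 2 * (E * ((m.1 : ℝ) + 1))) ^ 2) *
          Real.exp (-(0 + q * (E⁻¹ * ((m.2 : ℝ) + 1))) ^ 2) := fun m => by
      simpa using gaussian_add_le (y := q * (E⁻¹ * ((m.2 : ℝ) + 1))) hE hq.le hE0.le
        (by positivity) m.1
    have hs := (Summable.of_nonneg_of_le (fun m => (Real.exp_pos _).le) hle sAB).tsum_le_tsum
      hle sAB
    rw [← sA.tsum_mul_tsum sB sAB] at hs
    calc _ ≤ E⁻¹ * _ := mul_le_mul_of_nonneg_left hs (inv_nonneg.2 hE0.le)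
      _ = _ := by
        simp only [Function.comp_apply]
        ring

end Gaussian

/-- Ultrarelativistic asymptotics of the untwisted inertial detector response on the cylinder:
with `F_u(Ω; β)` the untwisted response at rapidity `β`,
`lim_{β→+∞} e^{−β} F_u(Ω; β) = erfc(σΩ)/(2L)`. -/
theorem untwisted_response_ultrarelativistic_limit (σ L Ω θ : ℝ)
    (hσ : 0 < σ) (hL : 0 < L) (hθ : θ ∈ Set.Icc (0 : ℝ) 1)
    (Fu : ℝ → ℝ)
    (hFu : ∀ β, Fu β =
      (4 * Real.sqrt Real.pi * σ / L ^ 2) *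
          ∑' p : ℕ × ℕ, Real.exp (-σ ^ 2 *
            (Ω + 2 * Real.pi * (((p.1 : ℝ) + 1) * Real.exp β
              + ((p.2 : ℝ) + 1) * Real.exp (-β)) / L) ^ 2)
        + (2 * Real.sqrt Real.pi * σ / L ^ 2) *
          ∑' n : ℕ, (Real.exp (-σ ^ 2 *
              (Ω + 2 * Real.pi * ((n : ℝ) + 1) * Real.exp β / L) ^ 2)
            + Real.exp (-σ ^ 2 *
              (Ω + 2 * Real.pi * ((n : ℝ) + 1) * Real.exp (-β) / L) ^ 2))
        + (2 * Real.sqrt Real.pi * σ * θ / L ^ 2) * Real.exp (-σ ^ 2 * Ω ^ 2)) :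
    Tendsto (fun β : ℝ => Real.exp (-β) * Fu β) atTop (𝓝 (erfc (σ * Ω) / (2 * L))) := by
  set p := σ * Ω with hp
  set q := σ * (2 * Real.pi / L) with hq_def
  have hq : 0 < q := by positivity
  have h1 := (tendsto_tsum_prod_gaussian p hq).comp Real.tendsto_exp_atTop
  have hinv : Tendsto (fun β : ℝ => (Real.exp β)⁻¹) atTop (𝓝 0) :=
    tendsto_inv_atTop_zero.comp Real.tendsto_exp_atTop
  have h2 := hinv.mul ((tendsto_tsum_gaussian_shift_atTop p hq).comp Real.tendsto_exp_atTop)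
  have h3 := (tendsto_gaussian_riemannSum p hq).comp
    (tendsto_inv_atTop_nhdsGT_zero.comp Real.tendsto_exp_atTop)
  have h := ((h1.const_mul (4 * Real.sqrt Real.pi * σ / L ^ 2)).add
    ((h2.add h3).const_mul (2 * Real.sqrt Real.pi * σ / L ^ 2))).add
    (hinv.mul_const ((2 * Real.sqrt Real.pi * σ * θ / L ^ 2) * Real.exp (-σ ^ 2 * Ω ^ 2)))
  convert! h using 2 with β
  · have e1 : ∀ m : ℕ × ℕ, Real.exp (-σ ^ 2 *
        (Ω + 2 * Real.pi * (((m.1 : ℝ) + 1) * Real.exp β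
          + ((m.2 : ℝ) + 1) * Real.exp (-β)) / L) ^ 2) =
        Real.exp (-(p + q * (Real.exp β * ((m.1 : ℝ) + 1))
          + q * ((Real.exp β)⁻¹ * ((m.2 : ℝ) + 1))) ^ 2) := fun m => by
      rw [Real.exp_neg β, hp, hq_def]
      congr 1
      ring
    have e2 : ∀ (x : ℝ) (n : ℕ), Real.exp (-σ ^ 2 *
        (Ω + 2 * Real.pi * ((n : ℝ) + 1) * x / L) ^ 2) =
        Real.exp (-(p + q * (x * ((n : ℝ) + 1))) ^ 2) := fun x n => by
      rw [hp, hq_def]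
      congr 1
      ring
    rw [hFu β]
    simp only [e1, e2, Function.comp_apply]
    rw [(summable_gaussian p hq (Real.exp_pos β)).tsum_add
      (summable_gaussian p hq (Real.exp_pos (-β))), Real.exp_neg β]
    ring
  · have hpi := Real.sq_sqrt Real.pi_pos.le
    rw [hq_def]
    have := Real.pi_pos.ne'
    field_simp
    linear_combination (-(erfc p * L)) * hpi
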